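/- In a finite cost game with exact potential Φ, every finite improvement path s₀, s₁, …, sₙ (each consecutive pair a unilateral improvement step) consists of pairwise distinct profiles; consequently its number of steps n is strictly less than the cardinality of the profile space Π j, S j. -/

import Mathlib

/-- `Φ` is an exact potential for the cost game with cost functions `u`:
for every player `i`, profile `s`, and strategy `a : S i`,
`u i (update s i a) - u i s = Φ (update s i a) - Φ s`. -/
def ExactPotential {ι : Type*} [DecidableEq ι] {S : ι → Type*}
    (u : (i : ι) → ((j : ι) → S j) → ℝ) (Φ : ((j : ι) → S j) → ℝ) : Prop :=
  ∀ (i : ι) (s : (j : ι) → S j) (a : S i),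
    u i (Function.update s i a) - u i s = Φ (Function.update s i a) - Φ s

/-- A unilateral improvement step from `s` to `s'`: some player `i` switches to a
strategy `a` (`s' = update s i a`) and strictly decreases its own cost. -/
def ImprovementStep {ι : Type*} [DecidableEq ι] {S : ι → Type*}
    (u : (i : ι) → ((j : ι) → S j) → ℝ) (s s' : (j : ι) → S j) : Prop :=
  ∃ (i : ι) (a : S i), s' = Function.update s i a ∧ u i s' < u i s

/-- `s` is a Nash equilibrium of the cost game `u`: no player can strictly
decrease its own cost by a unilateral deviation. -/
def NashEquilibrium {ι : Type*} [DecidableEq ι] {S : ι → Type*}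
    (u : (i : ι) → ((j : ι) → S j) → ℝ) (s : (j : ι) → S j) : Prop :=
  ∀ (i : ι) (a : S i), u i s ≤ u i (Function.update s i a)

/-- An improvement step strictly decreases an exact potential. -/
theorem ImprovementStep.potential_lt {ι : Type*} [DecidableEq ι] {S : ι → Type*}
    {u : (i : ι) → ((j : ι) → S j) → ℝ} {Φ : ((j : ι) → S j) → ℝ}
    (hΦ : ExactPotential u Φ) {s s' : (j : ι) → S j} (h : ImprovementStep u s s') :
    Φ s' < Φ s := by
  obtain ⟨i, a, rfl, hlt⟩ := h
  linarith [hΦ i s a]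

/-- Every finite improvement path consists of pairwise distinct
profiles; hence its number of steps is less than the cardinality of the
profile space. -/
theorem improvement_path_injective_and_short
    {ι : Type*} [Fintype ι] [Nonempty ι] [DecidableEq ι]
    {S : ι → Type*} [∀ i, Fintype (S i)] [∀ i, Nonempty (S i)]
    (u : (i : ι) → ((j : ι) → S j) → ℝ) (Φ : ((j : ι) → S j) → ℝ)
    (hΦ : ExactPotential u Φ)
    (n : ℕ) (s : Fin (n + 1) → ((j : ι) → S j))
    (hpath : ∀ k : Fin n, ImprovementStep u (s k.castSucc) (s k.succ)) :
    Function.Injective s ∧ n < Fintype.card ((j : ι) → S j) := by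
  have hanti : StrictAnti (Φ ∘ s) :=
    Fin.strictAnti_iff_succ_lt.2 fun k => (hpath k).potential_lt hΦ
  have hinj : Function.Injective s := hanti.injective.of_comp
  refine ⟨hinj, ?_⟩
  simpa [Nat.succ_le_iff] using Fintype.card_le_of_injective s hinj
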